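/- For every d ∈ ℕ, F_{GP_d} = F_{SGP_d}. Equivalently: a subset A ⊆ ℤ contains a set of the form ⋂_{i=1}^k {n ∈ ℤ : ‖P_i(n)‖ < ε_i} with P_i ∈ GP_d and ε_i > 0 if and only if it contains a set of the form ⋂_{j=1}^l {n ∈ ℤ : ‖Q_j(n)‖ < δ_j} with Q_j ∈ SGP_d and δ_j > 0. -/

import Mathlib

/-- `‖a‖`: the distance from a real number `a` to the nearest integer. -/
noncomputable def distToInt (a : ℝ) : ℝ := sInf (Set.range fun m : ℤ => |a - (m : ℝ)|)

/-- `⌈a⌉`: the least integer `m` with `|a − m| = ‖a‖`. -/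
noncomputable def nint (a : ℝ) : ℤ := sInf { m : ℤ | |a - (m : ℝ)| = distToInt a }

/-- The class `GP d` of generalized polynomials `ℤ → ℝ` of degree `≤ d`:
`GP 1` is generated by the maps `n ↦ a·n`; each `GP d` contains `GP e` for `e < d` and
the functions `n ↦ a₀ n^{p₀} ⌈f₁(n)⌉⋯⌈f_k(n)⌉` with `f_l ∈ GP (p l)` and
`p₀ + Σ p_l = d`; and each `GP d` is closed under `⌈·⌉`, scalar multiples and sums.
(No constructor produces `GP 0`, so the degrees `p l` are automatically `≥ 1`.) -/
inductive GP : ℕ → (ℤ → ℝ) → Prop where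
  | base (a : ℝ) : GP 1 (fun n => a * (n : ℝ))
  | incl {d e : ℕ} {f : ℤ → ℝ} (hf : GP e f) (hed : e < d) : GP d f
  | mono {d : ℕ} (a₀ : ℝ) (p₀ k : ℕ) (p : Fin k → ℕ) (f : Fin k → ℤ → ℝ)
      (hf : ∀ l, GP (p l) (f l)) (hsum : p₀ + ∑ l, p l = d) (hd : 1 ≤ d) :
      GP d (fun n => a₀ * (n : ℝ) ^ p₀ * ∏ l, (nint (f l n) : ℝ))
  | ceil {d : ℕ} {f : ℤ → ℝ} (hf : GP d f) : GP d (fun n => (nint (f n) : ℝ))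
  | smul {d : ℕ} {f : ℤ → ℝ} (c : ℝ) (hf : GP d f) : GP d (fun n => c * f n)
  | add {d : ℕ} {f g : ℤ → ℝ} (hf : GP d f) (hg : GP d g) : GP d (fun n => f n + g n)

/-- `L(a₁,…,a_ℓ)`: `L(a₁) = a₁` and `L(a₁,a₂,…,a_ℓ) = a₁⌈L(a₂,…,a_ℓ)⌉`. -/
noncomputable def Lfun : List ℝ → ℝ
  | [] => 0
  | [a] => a
  | a :: b :: rest => a * (nint (Lfun (b :: rest)) : ℝ)

/-- The class `SGP d` of special generalized polynomials of degree `≤ d`: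
the functions `n ↦ L(n^{j₁}a₁,…,n^{j_ℓ}a_ℓ)` with `1 ≤ ℓ ≤ d`, `j_t ≥ 1`, `Σ j_t ≤ d`. -/
def SGP (d : ℕ) (f : ℤ → ℝ) : Prop :=
  ∃ (ℓ : ℕ) (a : Fin ℓ → ℝ) (j : Fin ℓ → ℕ),
    1 ≤ ℓ ∧ ℓ ≤ d ∧ (∀ t, 1 ≤ j t) ∧ (∑ t, j t) ≤ d ∧
    f = fun n : ℤ => Lfun (List.ofFn fun t => (n : ℝ) ^ (j t) * a t)

/-- The family `F_{GP_d}` of subsets of `ℤ` containing some set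
`⋂_{i=1}^k {n : ‖P_i(n)‖ < ε_i}` with `P_i ∈ GP d` and `ε_i > 0`. -/
def FGP (d : ℕ) : Set (Set ℤ) :=
  { A | ∃ (k : ℕ) (P : Fin k → ℤ → ℝ) (ε : Fin k → ℝ),
      1 ≤ k ∧ (∀ i, GP d (P i)) ∧ (∀ i, 0 < ε i) ∧
      (⋂ i, { n : ℤ | distToInt (P i n) < ε i }) ⊆ A }

/-- The family `F_{SGP_d}`, defined like `F_{GP_d}` with `SGP d` in place of `GP d`. -/
def FSGP (d : ℕ) : Set (Set ℤ) :=
  { A | ∃ (k : ℕ) (P : Fin k → ℤ → ℝ) (ε : Fin k → ℝ),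
      1 ≤ k ∧ (∀ i, SGP d (P i)) ∧ (∀ i, 0 < ε i) ∧
      (⋂ i, { n : ℤ | distToInt (P i n) < ε i }) ⊆ A }

open Filter Topology

lemma distToInt_le (a : ℝ) (m : ℤ) : distToInt a ≤ |a - m| :=
  csInf_le ⟨0, by rintro _ ⟨m, rfl⟩; positivity⟩ ⟨m, rfl⟩

lemma abs_sub_round_eq_distToInt (a : ℝ) : |a - (round a : ℤ)| = distToInt a := by
  refine le_antisymm (le_csInf ⟨_, 0, rfl⟩ ?_) (distToInt_le a _)
  rintro _ ⟨m, rfl⟩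
  exact round_le a m

lemma abs_sub_nint (a : ℝ) : |a - nint a| = distToInt a := by
  have hne : { m : ℤ | |a - (m : ℝ)| = distToInt a }.Nonempty :=
    ⟨round a, abs_sub_round_eq_distToInt a⟩
  have hbdd : BddBelow { m : ℤ | |a - (m : ℝ)| = distToInt a } := by
    refine ⟨⌊a - distToInt a⌋, fun m hm => ?_⟩
    have h : a - distToInt a ≤ m := by
      have h1 : |a - m| = distToInt a := hm
      have h2 := le_abs_self (a - m)
      linarith
    exact_mod_cast (Int.floor_le _).trans h
  exact Int.csInf_mem hne hbdd

lemma nint_eq_of_abs_sub_lt {a : ℝ} {m : ℤ} (h : |a - m| < 1 / 2) : nint a = m := by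
  have h1 : |a - nint a| < 1 / 2 := (abs_sub_nint a).trans_lt ((distToInt_le a m).trans_lt h)
  rw [abs_lt] at h h1
  have h2 : (nint a : ℝ) < m + 1 := by linarith
  have h3 : (m : ℝ) < nint a + 1 := by linarith
  norm_cast at h2 h3
  omega

lemma nint_intCast (m : ℤ) : nint m = m := nint_eq_of_abs_sub_lt (by norm_num)

/-- `f` tends to `0` modulo `1` along `l`. -/
def NearInt (l : Filter ℤ) (f : ℤ → ℝ) : Prop :=
  Tendsto (fun n => f n - nint (f n)) l (𝓝 0)

section NearInt

variable {l : Filter ℤ} {f g : ℤ → ℝ}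

lemma eventually_nint_eq {m : ℤ → ℤ} (h : Tendsto (fun n => f n - m n) l (𝓝 0)) :
    ∀ᶠ n in l, nint (f n) = m n := by
  filter_upwards [Metric.tendsto_nhds.1 h (1 / 2) (by norm_num)] with n hn
  exact nint_eq_of_abs_sub_lt (by simpa using hn)

lemma NearInt.of_tendsto {m : ℤ → ℤ} (h : Tendsto (fun n => f n - m n) l (𝓝 0)) :
    NearInt l f := by
  refine h.congr' ?_
  filter_upwards [eventually_nint_eq h] with n hn
  rw [hn]

lemma NearInt.tendsto_add (hf : NearInt l f) (hg : NearInt l g) :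
    Tendsto (fun n => f n + g n - ((nint (f n) + nint (g n) : ℤ) : ℝ)) l (𝓝 0) := by
  have h := Tendsto.add hf hg
  rw [add_zero] at h
  refine h.congr fun n => ?_
  push_cast
  ring

lemma NearInt.tendsto_congr (hf : NearInt l f) (h : Tendsto (fun n => g n - f n) l (𝓝 0)) :
    Tendsto (fun n => g n - nint (f n)) l (𝓝 0) := by
  have h' := Tendsto.add hf h
  rw [add_zero] at h'
  exact h'.congr fun n => by ring

end NearInt

/-- The nested monomial `n ↦ a₁ n^{j₁}⌈a₂ n^{j₂}⌈⋯⌉⌉` attached to the word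
`(a₁, j₁), (a₂, j₂), …`; the empty word gives `1`. -/
noncomputable def nestedMonomial : List (ℝ × ℕ) → ℤ → ℝ
  | [], _ => 1
  | α :: u, n => (n : ℝ) ^ α.2 * α.1 * nint (nestedMonomial u n)

/-- The total degree of a word. -/
def wordDegree (u : List (ℝ × ℕ)) : ℕ := (u.map Prod.snd).sum

lemma nint_nestedMonomial_nil (n : ℤ) : nint (nestedMonomial [] n) = 1 := by
  simpa [nestedMonomial] using nint_intCast 1

lemma nestedMonomial_cons (α : ℝ × ℕ) (u : List (ℝ × ℕ)) (n : ℤ) :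
    nestedMonomial (α :: u) n = (n : ℝ) ^ α.2 * α.1 * nint (nestedMonomial u n) := rfl

lemma nestedMonomial_singleton (α : ℝ × ℕ) (n : ℤ) :
    nestedMonomial [α] n = (n : ℝ) ^ α.2 * α.1 := by
  rw [nestedMonomial_cons, nint_nestedMonomial_nil, Int.cast_one, mul_one]

@[simp] lemma wordDegree_nil : wordDegree [] = 0 := rfl

@[simp] lemma wordDegree_cons (α : ℝ × ℕ) (u : List (ℝ × ℕ)) :
    wordDegree (α :: u) = α.2 + wordDegree u := by simp [wordDegree]

/-- Words all of whose exponents are positive. -/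
def IsWord (u : List (ℝ × ℕ)) : Prop := ∀ α ∈ u, 1 ≤ α.2

lemma IsWord.length_le {u : List (ℝ × ℕ)} (hu : IsWord u) : u.length ≤ wordDegree u := by
  induction u with
  | nil => simp
  | cons α u ih =>
    have h1 := hu α (by simp)
    have h2 := ih fun β hβ => hu β (by simp [hβ])
    simp only [List.length_cons, wordDegree_cons]
    omega

lemma Lfun_map {u : List (ℝ × ℕ)} (hu : u ≠ []) (n : ℤ) :
    Lfun (u.map fun α => (n : ℝ) ^ α.2 * α.1) = nestedMonomial u n := by
  induction u with
  | nil => exact absurd rfl hu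
  | cons α u ih =>
    cases u with
    | nil => simp [Lfun, nestedMonomial_singleton]
    | cons β v =>
      have h := ih (by simp)
      simp only [List.map_cons] at h ⊢
      rw [Lfun, h, nestedMonomial_cons α]

lemma sgp_iff {d : ℕ} {f : ℤ → ℝ} :
    SGP d f ↔ ∃ u, u ≠ [] ∧ IsWord u ∧ wordDegree u ≤ d ∧ f = nestedMonomial u := by
  constructor
  · rintro ⟨ℓ, a, j, hℓ, -, hj, hsum, rfl⟩
    have hne : List.ofFn (fun t => (a t, j t)) ≠ [] := by
      rw [Ne, List.ofFn_eq_nil_iff]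
      omega
    refine ⟨List.ofFn fun t => (a t, j t), hne, ?_, ?_, ?_⟩
    · intro α hα
      obtain ⟨t, rfl⟩ := (List.mem_ofFn' _ _).1 hα
      exact hj t
    · simpa [wordDegree, List.map_ofFn, List.sum_ofFn] using hsum
    · funext n
      rw [← Lfun_map hne, List.map_ofFn]
      rfl
  · rintro ⟨u, hne, hu, hd, rfl⟩
    refine ⟨u.length, fun t => (u.get t).1, fun t => (u.get t).2,
      List.length_pos_iff.2 hne, hu.length_le.trans hd, fun t => hu _ (List.get_mem u t), ?_, ?_⟩
    · rw [← List.sum_ofFn]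
      have h : List.ofFn (fun t => (u.get t).2) = u.map Prod.snd := by
        conv_rhs => rw [← List.ofFn_get u, List.map_ofFn]
        rfl
      rw [h]
      exact hd
    · funext n
      rw [← Lfun_map hne]
      conv_lhs => rw [← List.ofFn_get u, List.map_ofFn]
      rfl

lemma gp_nestedMonomial {u : List (ℝ × ℕ)} (hne : u ≠ []) (hu : IsWord u) :
    GP (wordDegree u) (nestedMonomial u) := by
  induction u with
  | nil => exact absurd rfl hne
  | cons α u ih =>
    have hα := hu α (by simp)
    rcases eq_or_ne u [] with rfl | h
    · have h := GP.mono (d := α.2) α.1 α.2 0 Fin.elim0 Fin.elim0 (fun l => l.elim0) (by simp) hα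
      convert h using 1
      · simp
      · funext n
        simp [nestedMonomial_singleton, mul_comm]
    · have h := GP.mono (d := α.2 + wordDegree u) α.1 α.2 1 (fun _ => wordDegree u)
        (fun _ => nestedMonomial u) (fun _ => ih h fun β hβ => hu β (by simp [hβ]))
        (by simp) (by omega)
      convert h using 1
      · simp
      · funext n
        simp [nestedMonomial, mul_comm]

lemma GP.of_sgp {d : ℕ} {f : ℤ → ℝ} (hf : SGP d f) : GP d f := by
  obtain ⟨u, hne, hu, hd, rfl⟩ := sgp_iff.1 hf
  rcases hd.eq_or_lt with rfl | hlt
  · exact gp_nestedMonomial hne hu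
  · exact (gp_nestedMonomial hne hu).incl hlt

/-- Functions which, up to an error tending to `0` along `l`, are sums of nested monomials of
degree at most `e`. -/
inductive WordSum (l : Filter ℤ) (e : ℕ) : (ℤ → ℝ) → Prop where
  | word {u : List (ℝ × ℕ)} (hne : u ≠ []) (hu : IsWord u) (hd : wordDegree u ≤ e) :
      WordSum l e (nestedMonomial u)
  | add {f g : ℤ → ℝ} (hf : WordSum l e f) (hg : WordSum l e g) :
      WordSum l e (fun n => f n + g n)
  | congr {f g : ℤ → ℝ} (hf : WordSum l e f) (h : Tendsto (fun n => g n - f n) l (𝓝 0)) :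
      WordSum l e g

/-- Functions which are eventually along `l` integer combinations of nearest integers to nested
monomials of degree at most `e`. -/
inductive CeilSum (l : Filter ℤ) (e : ℕ) : (ℤ → ℝ) → Prop where
  | word {u : List (ℝ × ℕ)} (hne : u ≠ []) (hu : IsWord u) (hd : wordDegree u ≤ e) :
      CeilSum l e (fun n => nint (nestedMonomial u n))
  | add {f g : ℤ → ℝ} (hf : CeilSum l e f) (hg : CeilSum l e g) :
      CeilSum l e (fun n => f n + g n)
  | congr {f g : ℤ → ℝ} (hf : CeilSum l e f) (h : g =ᶠ[l] f) : CeilSum l e g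

section Sums

variable {l : Filter ℤ} {d e e' : ℕ} {f g : ℤ → ℝ}

lemma WordSum.mono (hf : WordSum l e f) (he : e ≤ e') : WordSum l e' f := by
  induction hf with
  | word hne hu hd => exact .word hne hu (hd.trans he)
  | add _ _ h1 h2 => exact h1.add h2
  | congr _ h h1 => exact h1.congr h

lemma WordSum.congr_eventuallyEq (hf : WordSum l e f) (h : g =ᶠ[l] f) : WordSum l e g := by
  refine hf.congr (tendsto_const_nhds.congr' ?_)
  filter_upwards [h] with n hn
  rw [hn, sub_self]

lemma WordSum.smul (c : ℝ) (hf : WordSum l e f) : WordSum l e (fun n => c * f n) := by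
  induction hf with
  | @word u hne hu hd =>
    cases u with
    | nil => exact absurd rfl hne
    | cons α u =>
      have hw : IsWord ((c * α.1, α.2) :: u) := by
        intro β hβ
        rcases List.mem_cons.1 hβ with rfl | hβ
        · exact hu α (by simp)
        · exact hu β (by simp [hβ])
      refine (WordSum.word (l := l) (e := e) (by simp) hw (by simpa using hd)).congr_eventuallyEq
        (.of_forall fun n => ?_)
      simp only [nestedMonomial]
      ring
  | add _ _ h1 h2 =>
    exact (h1.add h2).congr_eventuallyEq (.of_forall fun n => mul_add _ _ _)
  | congr _ h h1 =>
    refine h1.congr ?_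
    simpa [mul_sub] using h.const_mul c

lemma WordSum.nearInt (hl : ∀ u, u ≠ [] → IsWord u → wordDegree u ≤ d →
    NearInt l (nestedMonomial u)) (he : e ≤ d) (hf : WordSum l e f) : NearInt l f := by
  induction hf with
  | word hne hu hd => exact hl _ hne hu (hd.trans he)
  | add _ _ h1 h2 => exact .of_tendsto (h1.tendsto_add h2)
  | congr _ h h1 => exact .of_tendsto (h1.tendsto_congr h)

lemma WordSum.ceilSum (hl : ∀ u, u ≠ [] → IsWord u → wordDegree u ≤ d →
    NearInt l (nestedMonomial u)) (he : e ≤ d) (hf : WordSum l e f) :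
    CeilSum l e (fun n => nint (f n)) := by
  induction hf with
  | word hne hu hd => exact .word hne hu hd
  | add hf hg h1 h2 =>
    refine (h1.add h2).congr ?_
    filter_upwards [eventually_nint_eq ((hf.nearInt hl he).tendsto_add (hg.nearInt hl he))]
      with n hn
    rw [hn]
    push_cast
    rfl
  | congr hf h h1 =>
    refine h1.congr ?_
    filter_upwards [eventually_nint_eq ((hf.nearInt hl he).tendsto_congr h)] with n hn
    rw [hn]

lemma CeilSum.cons (a : ℝ) {j : ℕ} (hj : 1 ≤ j) (hf : CeilSum l e f) :
    WordSum l (j + e) (fun n => (n : ℝ) ^ j * a * f n) := by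
  induction hf with
  | @word u hne hu hd =>
    refine WordSum.word (u := (a, j) :: u) (by simp) ?_ (by simpa using hd)
    intro β hβ
    rcases List.mem_cons.1 hβ with rfl | hβ
    · exact hj
    · exact hu β hβ
  | add _ _ h1 h2 =>
    exact (h1.add h2).congr_eventuallyEq (.of_forall fun n => mul_add _ _ _)
  | congr _ h h1 =>
    refine h1.congr_eventuallyEq ?_
    filter_upwards [h] with n hn
    rw [hn]

lemma CeilSum.wordSum (hl : ∀ u, u ≠ [] → IsWord u → wordDegree u ≤ d →
    NearInt l (nestedMonomial u)) (he : e ≤ d) (hf : CeilSum l e f) : WordSum l e f := by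
  induction hf with
  | word hne hu hd =>
    refine (WordSum.word hne hu hd).congr ?_
    simpa using (hl _ hne hu (hd.trans he)).neg
  | add _ _ h1 h2 => exact h1.add h2
  | congr _ h h1 => exact h1.congr_eventuallyEq h

/-- The quasi-shuffle relation for nearest integers to nested monomials. -/
lemma ceilSum_mul_words (hl : ∀ u, u ≠ [] → IsWord u → wordDegree u ≤ d →
    NearInt l (nestedMonomial u)) (u v : List (ℝ × ℕ)) (hne : u ≠ [] ∨ v ≠ [])
    (hu : IsWord u) (hv : IsWord v) (hd : wordDegree u + wordDegree v ≤ d) :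
    CeilSum l (wordDegree u + wordDegree v)
      (fun n => (nint (nestedMonomial u n) : ℝ) * nint (nestedMonomial v n)) := by
  match u, v with
  | [], v =>
    have hv0 : v ≠ [] := by simpa using hne
    refine (CeilSum.word hv0 hv (by simp)).congr (.of_forall fun n => ?_)
    simp only [nint_nestedMonomial_nil, Int.cast_one, one_mul]
  | α :: u, [] =>
    refine (CeilSum.word (by simp) hu (by simp)).congr (.of_forall fun n => ?_)
    simp only [nint_nestedMonomial_nil, Int.cast_one, mul_one]
  | α :: u, β :: v =>
    have hα : 1 ≤ α.2 := hu α (by simp)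
    have hβ : 1 ≤ β.2 := hv β (by simp)
    have hu' : IsWord u := fun γ hγ => hu γ (by simp [hγ])
    have hv' : IsWord v := fun γ hγ => hv γ (by simp [hγ])
    simp only [wordDegree_cons] at hd ⊢
    have h1 := (ceilSum_mul_words hl u (β :: v) (by simp) hu' hv
      (by simp only [wordDegree_cons]; omega)).cons α.1 hα
    have h2 := (ceilSum_mul_words hl (α :: u) v (by simp) hu hv'
      (by simp only [wordDegree_cons]; omega)).cons β.1 hβ
    have h3 : WordSum l (α.2 + wordDegree u + (β.2 + wordDegree v)) (fun n =>
        nestedMonomial (α :: u) n * nestedMonomial (β :: v) n) := by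
      by_cases hne' : u ≠ [] ∨ v ≠ []
      · refine (((ceilSum_mul_words hl u v hne' hu' hv' (by omega)).cons (α.1 * β.1)
          (j := α.2 + β.2) (by omega)).mono (by omega)).congr_eventuallyEq (.of_forall fun n => ?_)
        simp only [nestedMonomial]
        ring
      · push Not at hne'
        obtain ⟨rfl, rfl⟩ := hne'
        have hw : IsWord [(α.1 * β.1, α.2 + β.2)] := by
          intro γ hγ
          rw [List.mem_singleton.1 hγ]
          exact Nat.le_add_right_of_le hα
        refine (WordSum.word (by simp) hw (by simp)).congr_eventuallyEq (.of_forall fun n => ?_)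
        simp only [nestedMonomial_singleton]
        ring
    have hU : NearInt l (nestedMonomial (α :: u)) :=
      hl _ (by simp) hu (by simp only [wordDegree_cons]; omega)
    have hV : NearInt l (nestedMonomial (β :: v)) :=
      hl _ (by simp) hv (by simp only [wordDegree_cons]; omega)
    have hsum : WordSum l (α.2 + wordDegree u + (β.2 + wordDegree v)) (fun n =>
        (nint (nestedMonomial (α :: u) n) : ℝ) * nint (nestedMonomial (β :: v) n)) := by
      refine (((h1.mono (by simp only [wordDegree_cons]; omega)).add
        (h2.mono (by simp only [wordDegree_cons]; omega))).add (h3.smul (-1))).congr ?_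
      have h := Tendsto.mul hU hV
      rw [mul_zero] at h
      refine h.congr fun n => ?_
      simp only [nestedMonomial_cons α, nestedMonomial_cons β]
      ring
    refine (hsum.ceilSum hl hd).congr (.of_forall fun n => ?_)
    simp only [← Int.cast_mul, nint_intCast]
  termination_by u.length + v.length

lemma CeilSum.mul (hl : ∀ u, u ≠ [] → IsWord u → wordDegree u ≤ d →
    NearInt l (nestedMonomial u)) (he : e + e' ≤ d) (hf : CeilSum l e f) (hg : CeilSum l e' g) :
    CeilSum l (e + e') (fun n => f n * g n) := by
  induction hf with
  | word hne hu hd =>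
    induction hg with
    | word hne' hv hd' =>
      have h := ceilSum_mul_words hl _ _ (Or.inl hne) hu hv ((add_le_add hd hd').trans he)
      have hw := ((h.wordSum hl ((add_le_add hd hd').trans he)).mono (add_le_add hd hd')).ceilSum
        hl he
      refine hw.congr (.of_forall fun n => ?_)
      simp only [← Int.cast_mul, nint_intCast]
    | add _ _ h1 h2 => exact (h1.add h2).congr (.of_forall fun n => mul_add _ _ _)
    | congr _ h h1 =>
      refine h1.congr ?_
      filter_upwards [h] with n hn
      rw [hn]
  | add _ _ h1 h2 => exact (h1.add h2).congr (.of_forall fun n => add_mul _ _ _)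
  | congr _ h h1 =>
    refine h1.congr ?_
    filter_upwards [h] with n hn
    rw [hn]

lemma CeilSum.prod (hl : ∀ u, u ≠ [] → IsWord u → wordDegree u ≤ d →
    NearInt l (nestedMonomial u)) {k : ℕ} (p : Fin (k + 1) → ℕ) (f : Fin (k + 1) → ℤ → ℝ)
    (hf : ∀ i, CeilSum l (p i) (f i)) (hp : ∑ i, p i ≤ d) :
    CeilSum l (∑ i, p i) (fun n => ∏ i, f i n) := by
  induction k with
  | zero => simpa using hf 0
  | succ k ih =>
    rw [Fin.sum_univ_succ] at hp ⊢
    have h := (hf 0).mul hl hp (ih (fun i => p i.succ) (fun i => f i.succ) (fun i => hf i.succ)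
      ((Nat.le_add_left _ _).trans hp))
    exact h.congr (.of_forall fun n => Fin.prod_univ_succ _)

theorem GP.wordSum (hl : ∀ u, u ≠ [] → IsWord u → wordDegree u ≤ d →
    NearInt l (nestedMonomial u)) (hf : GP e f) (he : e ≤ d) : WordSum l e f := by
  have monomial : ∀ (a : ℝ) {j : ℕ}, 1 ≤ j → WordSum l j (fun n => a * (n : ℝ) ^ j) := by
    intro a j hj
    have hw : IsWord [(a, j)] := by
      intro γ hγ
      rw [List.mem_singleton.1 hγ]
      exact hj
    refine (WordSum.word (by simp) hw (by simp)).congr_eventuallyEq (.of_forall fun n => ?_)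
    simp only [nestedMonomial_singleton]
    ring
  induction hf with
  | base a => simpa using monomial a le_rfl
  | incl _ hed ih => exact (ih (hed.le.trans he)).mono hed.le
  | ceil _ ih =>
    refine (ih he).congr ?_
    simpa using ((ih he).nearInt hl he).neg
  | smul c _ ih => exact (ih he).smul c
  | add _ _ h1 h2 => exact (h1 he).add (h2 he)
  | mono a p₀ k p f _ hsum hd ih =>
    subst hsum
    cases k with
    | zero => simpa using monomial a (by simpa using hd)
    | succ k =>
      have hp : ∀ i, p i ≤ d := fun i =>
        (Finset.single_le_sum (fun _ _ => Nat.zero_le _) (Finset.mem_univ i)).trans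
          ((Nat.le_add_left _ _).trans he)
      have hprod := CeilSum.prod hl p (fun i n => (nint (f i n) : ℝ))
        (fun i => (ih i (hp i)).ceilSum hl (hp i)) ((Nat.le_add_left _ _).trans he)
      rcases Nat.eq_zero_or_pos p₀ with rfl | hp₀
      · refine (((hprod.wordSum hl ((Nat.le_add_left _ _).trans he)).smul a).mono
          (by simp)).congr_eventuallyEq (.of_forall fun n => ?_)
        simp
      · refine (hprod.cons a hp₀).congr_eventuallyEq (.of_forall fun n => ?_)
        ring

end Sums

/-- The family `FSGP d`, as a filter on `ℤ`. -/
def sgpFilter (d : ℕ) (hd : 1 ≤ d) : Filter ℤ where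
  sets := FSGP d
  univ_sets := by
    refine ⟨1, fun _ => nestedMonomial [(0, 1)], fun _ => 1, le_rfl, fun _ => ?_,
      fun _ => one_pos, Set.subset_univ _⟩
    exact sgp_iff.2 ⟨_, by simp, by simp [IsWord], by simpa using hd, rfl⟩
  sets_of_superset := by
    rintro A B ⟨k, P, ε, hk, hP, hε, hA⟩ hAB
    exact ⟨k, P, ε, hk, hP, hε, hA.trans hAB⟩
  inter_sets := by
    rintro A B ⟨k, P, ε, hk, hP, hε, hA⟩ ⟨k', P', ε', hk', hP', hε', hB⟩
    refine ⟨k + k', Fin.append P P', Fin.append ε ε', by omega, fun i => ?_, fun i => ?_, ?_⟩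
    · refine Fin.addCases (fun i => ?_) (fun i => ?_) i
      · simpa using hP i
      · simpa using hP' i
    · refine Fin.addCases (fun i => ?_) (fun i => ?_) i
      · simpa using hε i
      · simpa using hε' i
    · intro n hn
      rw [Set.mem_iInter] at hn
      refine ⟨hA (Set.mem_iInter.2 fun i => ?_), hB (Set.mem_iInter.2 fun i => ?_)⟩
      · simpa using hn (Fin.castAdd k' i)
      · simpa using hn (Fin.natAdd k i)

lemma nearInt_sgpFilter {d : ℕ} (hd : 1 ≤ d) {f : ℤ → ℝ} (hf : SGP d f) :
    NearInt (sgpFilter d hd) f := by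
  refine Metric.tendsto_nhds.2 fun ε hε => ?_
  have h : { n : ℤ | distToInt (f n) < ε } ∈ sgpFilter d hd :=
    ⟨1, fun _ => f, fun _ => ε, le_rfl, fun _ => hf, fun _ => hε,
      Set.iInter_subset (fun _ : Fin 1 => { n : ℤ | distToInt (f n) < ε }) 0⟩
  filter_upwards [h] with n hn
  simpa [abs_sub_nint] using hn

theorem stmt_11 (d : ℕ) (hd : 1 ≤ d) : FGP d = FSGP d := by
  refine Set.Subset.antisymm ?_ ?_
  · rintro A ⟨k, P, ε, -, hP, hε, hA⟩
    have hl : ∀ u, u ≠ [] → IsWord u → wordDegree u ≤ d →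
        NearInt (sgpFilter d hd) (nestedMonomial u) := fun u hne hu hdu =>
      nearInt_sgpFilter hd (sgp_iff.2 ⟨u, hne, hu, hdu, rfl⟩)
    refine (sgpFilter d hd).sets_of_superset ((Filter.iInter_mem).2 fun i => ?_) hA
    have h := ((hP i).wordSum hl le_rfl).nearInt hl le_rfl
    filter_upwards [Metric.tendsto_nhds.1 h (ε i) (hε i)] with n hn
    simpa [abs_sub_nint] using hn
  · rintro A ⟨k, P, ε, hk, hP, hε, hA⟩
    exact ⟨k, P, ε, hk, fun i => GP.of_sgp (hP i), hε, hA⟩
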